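/- Let F : ℝ^n → ℝ^n be a bijection such that both F and its inverse F⁻¹ are differentiable. Let A be a real n × n matrix admitting a basis of real eigenvectors with all eigenvalues negative (there exist λ : Fin n → ℝ and r : Fin n → ℝ^n with A·r_k = λ_k r_k for each k, {r_k} spanning ℝ^n, and λ_k < 0 for all k). Let g(x) = A·x and let f be the pushforward dynamics f(y) = DF(F⁻¹(y))[g(F⁻¹(y))]. Then every integral curve y of f converges to F(0): y(t) → F(0) as t → ∞. -/

import Mathlib

open Filter Topology

/-- A solution of the scalar equation `c' = m c` with `m < 0` tends to `0`. -/
theorem tendsto_zero_of_hasDerivAt_mul_self {m : ℝ} (hm : m < 0) {c : ℝ → ℝ}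
    (hc : ∀ t, HasDerivAt c (m * c t) t) : Tendsto c atTop (𝓝 0) := by
  have hexp (t : ℝ) : HasDerivAt (fun s ↦ Real.exp (-(m * s))) (Real.exp (-(m * t)) * -m) t := by
    simpa using ((hasDerivAt_id t).const_mul m).neg.exp
  have hderiv (t : ℝ) : HasDerivAt (fun s ↦ Real.exp (-(m * s)) * c s) 0 t :=
    ((hexp t).mul (hc t)).congr_deriv (by ring)
  have hconst (t : ℝ) : Real.exp (-(m * t)) * c t = c 0 := by
    simpa using is_const_of_deriv_eq_zero (fun s ↦ (hderiv s).differentiableAt)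
      (fun s ↦ (hderiv s).deriv) t 0
  have hsol : c = fun t ↦ Real.exp (m * t) * c 0 := by
    funext t
    rw [← hconst t, ← mul_assoc, ← Real.exp_add]
    simp
  rw [hsol]
  simpa using (Real.tendsto_exp_atBot.comp
    (tendsto_id.const_mul_atTop_of_neg hm)).mul_const (c 0)

/-- Solutions of `x' = L x` tend to `0` if `L` has a basis of eigenvectors with negative
eigenvalues. -/
theorem tendsto_zero_of_hasDerivAt_of_basis {ι E : Type*} [Fintype ι] [NormedAddCommGroup E]
    [NormedSpace ℝ E] (b : Module.Basis ι ℝ E) (L : E →ₗ[ℝ] E)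
    {μ : ι → ℝ} (hb : ∀ k, L (b k) = μ k • b k) (hneg : ∀ k, μ k < 0) {x : ℝ → E}
    (hx : ∀ t, HasDerivAt x (L (x t)) t) : Tendsto x atTop (𝓝 0) := by
  have : FiniteDimensional ℝ E := b.finiteDimensional_of_finite
  have hcoord (k : ι) (v : E) : b.coord k (L v) = μ k * b.coord k v := by
    have h : b.coord k ∘ₗ L = μ k • b.coord k := by
      classical
      refine b.ext fun j ↦ ?_
      by_cases hjk : j = k
      · subst hjk; simp [hb]
      · simp [hb, hjk]
    simpa using LinearMap.congr_fun h v
  have hlim (k : ι) : Tendsto (fun t ↦ b.coord k (x t)) atTop (𝓝 0) := by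
    refine tendsto_zero_of_hasDerivAt_mul_self (hneg k) fun t ↦ ?_
    rw [← hcoord]
    exact (b.coord k).toContinuousLinearMap.hasFDerivAt.comp_hasDerivAt t (hx t)
  have hsum : Tendsto (fun t ↦ ∑ k, b.coord k (x t) • b k) atTop (𝓝 (∑ k, (0 : ℝ) • b k)) :=
    tendsto_finsetSum _ fun k _ ↦ (hlim k).smul_const (b k)
  simpa [b.sum_repr] using hsum

/-- A differentiable left inverse of `F` maps integral curves of the pushforward along `F` of a
vector field `g` to integral curves of `g`. -/
theorem hasDerivAt_comp_of_pushforward {E E' : Type*} [NormedAddCommGroup E] [NormedSpace ℝ E]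
    [NormedAddCommGroup E'] [NormedSpace ℝ E'] {F : E → E'} {G : E' → E}
    (hFG : Function.LeftInverse G F) (hGF : Function.RightInverse G F)
    (hF : Differentiable ℝ F) (hG : Differentiable ℝ G) {g : E → E} {y : ℝ → E'} {t : ℝ}
    (hy : HasDerivAt y (fderiv ℝ F (G (y t)) (g (G (y t)))) t) :
    HasDerivAt (fun s ↦ G (y s)) (g (G (y t))) t := by
  have hG' : HasFDerivAt G (fderiv ℝ G (y t)) (F (G (y t))) := by
    rw [hGF]
    exact (hG _).hasFDerivAt
  have hcomp := hG'.comp (G (y t)) (hF _).hasFDerivAt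
  rw [hFG.comp_eq_id] at hcomp
  have hid := hcomp.unique (hasFDerivAt_id _)
  exact ((hG _).hasFDerivAt.comp_hasDerivAt t hy).congr_deriv
    (DFunLike.congr_fun hid (g (G (y t))))


/-- If the base linear ODE `x' = A x` is asymptotically stable (spanning real
eigenvectors, negative eigenvalues), then every integral curve of the pushforward
dynamics `f` converges to `F 0`. -/
theorem stmt_11 (n : ℕ) (F G : (Fin n → ℝ) → (Fin n → ℝ))
    (hFG : Function.LeftInverse G F) (hGF : Function.RightInverse G F)
    (hF : Differentiable ℝ F) (hG : Differentiable ℝ G)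
    (A : Matrix (Fin n) (Fin n) ℝ)
    (μ : Fin n → ℝ) (r : Fin n → (Fin n → ℝ))
    (hr : ∀ k, A.mulVec (r k) = μ k • r k)
    (hspan : Submodule.span ℝ (Set.range r) = ⊤)
    (hneg : ∀ k, μ k < 0)
    (g f : (Fin n → ℝ) → (Fin n → ℝ))
    (hg : ∀ x, g x = A.mulVec x)
    (hf : ∀ y, f y = fderiv ℝ F (G y) (g (G y))) :
    ∀ y : ℝ → (Fin n → ℝ), (∀ t, HasDerivAt y (f (y t)) t) →
      Filter.Tendsto y Filter.atTop (nhds (F 0)) := by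
  intro y hy
  have hcard : Fintype.card (Fin n) = Module.finrank ℝ (Fin n → ℝ) := by simp
  have hx : Tendsto (fun t ↦ G (y t)) atTop (𝓝 0) := by
    refine tendsto_zero_of_hasDerivAt_of_basis
      (basisOfTopLeSpanOfCardEqFinrank r hspan.ge hcard) A.mulVecLin (μ := μ)
      (fun k ↦ by simpa using hr k) hneg fun t ↦ ?_
    have h := hasDerivAt_comp_of_pushforward (g := g) hFG hGF hF hG ((hf (y t)) ▸ hy t)
    rwa [hg] at h
  simpa only [Function.comp_def, hGF (y _)] using (hF.continuous.tendsto 0).comp hx
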